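/- arXiv:2408.07017 — 2 statements merged into one kernel-verified Lean document; each statement's English description precedes it below -/
import Mathlib

section
/- Let h be a Hessenberg function on {1,…,n} and s = diag(1, 0, …, 0). Then the Krull dimension of the quotient ring R / I_{s,h} equals n(n+1)/2 + (n−1)(n−2)/2 + max_{i ∈ C(h)} (h(i) − i), the maximum over the corner set C(h) of h. -/
open MvPolynomial

noncomputable section

/-- The polynomial ring `R = ℂ[z_{ij} : 1 ≤ i,j ≤ n]` (indices 0-based). -/
abbrev R (n : ℕ) : Type := MvPolynomial (Fin n × Fin n) ℂ

/-- The ideal `L_i = ⟨z_{11}, …, z_{1i}⟩` (first row, first `i` variables; 0-based columns `j < i`).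
    `Lideal n 0 = ⟨0⟩`. -/
def Lideal (n : ℕ) [NeZero n] (i : ℕ) : Ideal (R n) :=
  Ideal.span { p | ∃ j : Fin n, (j : ℕ) < i ∧ p = X ((0 : Fin n), j) }

/-- The ideal `K_j`, generated by the `j × j` minors `p_B = det((z_{kℓ})_{k ∈ B, 1 ≤ ℓ ≤ j})`
    over all `j`-element subsets `B ⊆ {2, …, n}` (0-based: rows `B k ≠ 0`, columns `0,…,j-1`).
    For `j = n` (or `j > n`) there are no such subsets and the ideal is `⟨0⟩`. -/
def Kideal (n : ℕ) (j : ℕ) : Ideal (R n) :=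
  Ideal.span { p | ∃ (hj : j ≤ n) (B : Fin j → Fin n), StrictMono B ∧ (∀ k, (B k : ℕ) ≠ 0) ∧
    p = (Matrix.of fun k l : Fin j => (X (B k, Fin.castLE hj l) : R n)).det }

/-- A Hessenberg function (0-based): `h` is monotone with `h i ≥ i` for all `i`. -/
def IsHessenberg (n : ℕ) (h : Fin n → Fin n) : Prop := Monotone h ∧ ∀ i, i ≤ h i

/-- `i` is a corner of `h`, i.e. (1-based) `h(i) > h(i-1)` with the convention `h(0) = 0`;
    0-based, `i = 0` is always a corner. -/
def HessCorner (n : ℕ) (h : Fin n → Fin n) (i : Fin n) : Prop :=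
  (i : ℕ) = 0 ∨ h ⟨(i : ℕ) - 1, lt_of_le_of_lt (Nat.sub_le _ _) i.isLt⟩ < h i

/-- The `n × (i + h(i))` matrix with columns `x·v_1, …, x·v_i, v_1, …, v_{h(i)}`,
    where `v_j` is the `j`-th column of the generic matrix `Z`. Here (0-based) the paper's
    `i` is `a+1` and the paper's `h(i)` is `(h a) + 1`. -/
def hessMat (n : ℕ) (x : Matrix (Fin n) (Fin n) ℂ) (h : Fin n → Fin n) (a : Fin n) :
    Matrix (Fin n) (Fin ((a : ℕ) + 1) ⊕ Fin (((h a) : ℕ) + 1)) (R n) :=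
  Matrix.of fun r c => Sum.elim
    (fun c' => ∑ k : Fin n, MvPolynomial.C (x r k) * X (k, Fin.castLE a.isLt c'))
    (fun c' => X (r, Fin.castLE (h a).isLt c')) c

/-- The ideal `I_{x,h,i}` generated by all `(h(i)+1) × (h(i)+1)` minors of `hessMat`
    (paper's `h(i)+1` is `(h a) + 2` 0-based). -/
def hessIdealAt (n : ℕ) (x : Matrix (Fin n) (Fin n) ℂ) (h : Fin n → Fin n) (a : Fin n) :
    Ideal (R n) :=
  Ideal.span { p | ∃ (f : Fin (((h a) : ℕ) + 2) → Fin n)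
    (g : Fin (((h a) : ℕ) + 2) → Fin ((a : ℕ) + 1) ⊕ Fin (((h a) : ℕ) + 1)),
    p = ((hessMat n x h a).submatrix f g).det }

/-- The ideal `I_{x,h} = Σ_{i=1}^n I_{x,h,i}`. -/
def hessIdeal (n : ℕ) (x : Matrix (Fin n) (Fin n) ℂ) (h : Fin n → Fin n) : Ideal (R n) :=
  ∑ a : Fin n, hessIdealAt n x h a

/-- The minimal semisimple element `s = diag(1, 0, …, 0)`. -/
def sMat (n : ℕ) [NeZero n] : Matrix (Fin n) (Fin n) ℂ :=
  Matrix.diagonal (fun i => if i = 0 then 1 else 0)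

/-- The rank `r_{pq}(w)` of the top-left `(p+1) × (q+1)` (0-based) submatrix of the
    permutation matrix of `w`. -/
def rankpq (n : ℕ) (w : Equiv.Perm (Fin n)) (p q : Fin n) : ℕ :=
  (Finset.univ.filter fun j : Fin n => j ≤ q ∧ w j ≤ p).card

/-- The Schubert determinantal ideal `I_w`: generated, over all `p, q`, by the minors of size
    `1 + r_{pq}(w)` of the top-left `(p+1) × (q+1)` (0-based) submatrix of the generic matrix. -/
def schubertIdeal (n : ℕ) (w : Equiv.Perm (Fin n)) : Ideal (R n) :=
  Ideal.span { m | ∃ (p q : Fin n) (f g : Fin (rankpq n w p q + 1) → Fin n),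
    (∀ k, f k ≤ p) ∧ (∀ k, g k ≤ q) ∧
    m = (Matrix.of fun k l => (X (f k, g l) : R n)).det }

/-- The generic matrix `Z`. -/
def genZ (n : ℕ) : Matrix (Fin n) (Fin n) (R n) :=
  Matrix.of fun k l => X (k, l)

theorem ringKrullDim_le_of_isIntegral (A B : Type*) [CommRing A] [CommRing B] [Algebra A B]
    [Algebra.IsIntegral A B] : ringKrullDim B ≤ ringKrullDim A :=
  Order.krullDim_le_of_strictMono (PrimeSpectrum.comap (algebraMap A B)) fun _ _ hIJ ↦
    Ideal.IsIntegral.comap_lt_comap hIJ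

theorem ringKrullDim_le_of_isIntegral_of_injective (A B : Type*) [CommRing A] [CommRing B]
    [Algebra A B] [Algebra.IsIntegral A B] (hinj : Function.Injective (algebraMap A B)) :
    ringKrullDim A ≤ ringKrullDim B := by
  refine iSup_le fun l ↦ ?_
  obtain ⟨Q, -, hQ, hQc⟩ := Ideal.exists_ideal_over_prime_of_isIntegral l.head.asIdeal
    (⊥ : Ideal B) (((RingHom.injective_iff_ker_eq_bot _).mp hinj).le.trans bot_le)
  have : Q.LiesOver l.head.asIdeal := ⟨hQc.symm⟩
  obtain ⟨L, hL, -⟩ := Ideal.exists_ltSeries_of_hasGoingUp l Q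
  rw [← hL]
  exact Order.LTSeries.length_le_krullDim L

theorem exists_trdeg_eq_and_ringKrullDim_eq (k B : Type*) [Field k] [CommRing B] [IsDomain B]
    [Algebra k B] [Algebra.FiniteType k B] :
    ∃ s : ℕ, Algebra.trdeg k B = s ∧ ringKrullDim B = s := by
  obtain ⟨s, g, hg, hint⟩ := exists_integral_inj_algHom_of_fg k B
  refine ⟨s, ?_, ?_⟩
  · let := g.toRingHom.toAlgebra
    have : Algebra.IsIntegral (MvPolynomial (Fin s) k) B := ⟨hint⟩
    have : IsScalarTower k (MvPolynomial (Fin s) k) B := .of_algHom g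
    have : FaithfulSMul (MvPolynomial (Fin s) k) B :=
      (faithfulSMul_iff_algebraMap_injective _ _).mpr hg
    have hb := (IsTranscendenceBasis.mvPolynomial (Fin s) k).algebraMap_comp (A := B)
    simpa using hb.lift_cardinalMk_eq_trdeg.symm
  · let := g.toRingHom.toAlgebra
    have : Algebra.IsIntegral (MvPolynomial (Fin s) k) B := ⟨hint⟩
    have hs : ringKrullDim (MvPolynomial (Fin s) k) = s := by simp
    rw [← hs]
    exact le_antisymm (ringKrullDim_le_of_isIntegral _ _)
      (ringKrullDim_le_of_isIntegral_of_injective _ _ hg)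

theorem ringKrullDim_quotient_le_of_forall_isPrime {A : Type*} [CommRing A] (I : Ideal A)
    (N : WithBot ℕ∞) (hN : ∀ P : Ideal A, P.IsPrime → I ≤ P → ringKrullDim (A ⧸ P) ≤ N) :
    ringKrullDim (A ⧸ I) ≤ N := by
  rw [ringKrullDim_quotient]
  refine iSup_le fun l ↦ ?_
  refine le_trans ?_ (hN l.head.1.asIdeal l.head.1.isPrime l.head.2)
  rw [ringKrullDim_quotient]
  let L : LTSeries (PrimeSpectrum.zeroLocus (l.head.1.asIdeal : Set A)) :=
    { length := l.length
      toFun := fun i ↦ ⟨(l i).1, l.head_le i⟩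
      step := fun i ↦ l.step i }
  exact Order.LTSeries.length_le_krullDim L

theorem ringKrullDim_le_card_of_mem_range {k B F : Type*} [Field k] [CommRing B] [IsDomain B]
    [Algebra k B] [Algebra.FiniteType k B] [Field F] [Algebra k F] (g : B →ₐ[k] F)
    (hg : Function.Injective g) {σ : Type} [Fintype σ] (x : σ → F)
    (hx : g.range ≤ (aeval (R := k) x).range) : ringKrullDim B ≤ Fintype.card σ := by
  obtain ⟨s, hs, hd⟩ := exists_trdeg_eq_and_ringKrullDim_eq k B
  have h1 := lift_trdeg_le_of_injective
    ((Subalgebra.inclusion hx).comp g.rangeRestrict)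
    ((Subalgebra.inclusion_injective hx).comp (fun a b hab ↦ hg (congrArg Subtype.val hab)))
  have h2 := lift_trdeg_le_of_surjective (aeval (R := k) x).rangeRestrict
    (aeval (R := k) x).rangeRestrict_surjective
  rw [hs] at h1
  rw [hd]
  simp at h1 h2
  exact_mod_cast h1.trans h2

theorem card_le_ringKrullDim_of_algebraicIndependent {k B : Type*} [Field k] [CommRing B]
    [IsDomain B] [Algebra k B] [Algebra.FiniteType k B] {σ : Type} [Fintype σ] (x : σ → B)
    (hx : AlgebraicIndependent k x) : Fintype.card σ ≤ ringKrullDim B := by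
  obtain ⟨s, hs, hd⟩ := exists_trdeg_eq_and_ringKrullDim_eq k B
  have h1 := hx.lift_cardinalMk_le_trdeg
  rw [hs] at h1
  rw [hd]
  simp at h1
  exact_mod_cast h1

theorem det_submatrix_eq_zero_of_forall_mem_span {K : Type*} [Field K] {m c ι : Type*} [Fintype ι]
    {q : ℕ} (M : Matrix m c K) (w : ι → m → K) (hq : Fintype.card ι < q)
    (hM : ∀ j, (fun i ↦ M i j) ∈ Submodule.span K (Set.range w)) (f : Fin q → m) (g : Fin q → c) :
    (M.submatrix f g).det = 0 := by
  refine Matrix.det_eq_zero_of_not_linearIndependent_cols fun hli ↦ ?_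
  have hle : Submodule.span K (Set.range (M.submatrix f g).col) ≤
      (Submodule.span K (Set.range w)).map (LinearMap.funLeft K K f) := by
    rw [Submodule.span_le]
    rintro _ ⟨j, rfl⟩
    exact ⟨_, hM (g j), rfl⟩
  have hw : (Submodule.span K (Set.range w)).FG := Submodule.fg_span (Set.finite_range w)
  have : Module.Finite K (Submodule.span K (Set.range w)) := Module.Finite.iff_fg.mpr hw
  have h1 := (Submodule.finrank_mono hle).trans ((Submodule.finrank_map_le _ _).trans
    (finrank_range_le_card w))
  have h2 := finrank_span_eq_card hli
  rw [Fintype.card_fin] at h2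
  exact absurd (h2.symm.trans_le h1) (by omega)

theorem exists_det_submatrix_ne_zero {K : Type*} [Field K] {m : Type*} [Fintype m] {q : ℕ}
    (M : Matrix m (Fin q) K) (hM : LinearIndependent K M.col) :
    ∃ f : Fin q → m, (M.submatrix f id).det ≠ 0 := by
  have hr : Module.finrank K (Submodule.span K (Set.range M.row)) = q := by
    rw [← Matrix.rank_eq_finrank_span_row, ← M.rank_transpose]
    simpa using LinearIndependent.rank_matrix (M := M.transpose) hM
  obtain ⟨f, hf, -, hli⟩ := Submodule.exists_fun_fin_finrank_span_eq K (Set.range M.row)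
  choose e he using hf
  refine ⟨fun i ↦ e (Fin.cast hr.symm i), ?_⟩
  have h2 : LinearIndependent K (M.submatrix (fun i ↦ e (Fin.cast hr.symm i)) id).row := by
    have hrow : (M.submatrix (fun i ↦ e (Fin.cast hr.symm i)) id).row = f ∘ Fin.cast hr.symm :=
      funext fun i ↦ he (Fin.cast hr.symm i)
    rw [hrow]
    exact hli.comp (Fin.cast hr.symm) (Fin.cast_injective _)
  exact ((Matrix.isUnit_iff_isUnit_det _).mp (Matrix.linearIndependent_rows_iff_isUnit.mp h2)).ne_zero

/-- The index type of a transcendence basis of the component of `hessIdeal n (sMat n) h` on which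
the first-row entries left of column `k` vanish and, below the first row, column `l` depends on
the other columns up to column `j`. -/
abbrev HessIndex (n : ℕ) [NeZero n] (k j l : Fin n) : Type :=
  {m : Fin n // k ≤ m} ⊕ ({r : Fin n // r ≠ 0} × {m : Fin n // m ≠ l}) ⊕
    {m : Fin n // m ≤ j ∧ m ≠ l}

theorem card_hessIndex (n : ℕ) [NeZero n] (k j l : Fin n) (hkj : k ≤ j) (hlj : l ≤ j) :
    Fintype.card (HessIndex n k j l) =
      n * (n + 1) / 2 + (n - 1) * (n - 2) / 2 + ((j : ℕ) - k) := by
  have h1 : Fintype.card {m : Fin n // k ≤ m} = n - k := by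
    rw [Fintype.card_subtype, Finset.filter_le_eq_Ici, Fin.card_Ici]
  have h2 (l : Fin n) : Fintype.card {m : Fin n // m ≠ l} = n - 1 := by
    simp [Fintype.card_subtype_compl]
  have h3 : Fintype.card {m : Fin n // m ≤ j ∧ m ≠ l} = j := by
    have : (Finset.univ.filter fun m : Fin n ↦ m ≤ j ∧ m ≠ l) = (Finset.Iic j).erase l := by
      ext; simp [and_comm]
    rw [Fintype.card_subtype, this, Finset.card_erase_of_mem (by simpa), Fin.card_Iic]
    rfl
  rw [Fintype.card_sum, Fintype.card_sum, Fintype.card_prod, h1, h2, h2, h3]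
  obtain ⟨p, rfl⟩ : ∃ p, n = p + 1 := ⟨n - 1, by have := NeZero.pos n; omega⟩
  have hk := k.isLt
  have hkj' : (k : ℕ) ≤ j := hkj
  have h4 : (p + 1) * (p + 1 + 1) / 2 + (p + 1 - 1) * (p + 1 - 2) / 2 = p * p + p + 1 := by
    rcases p with _ | q
    · rfl
    have e1 : (q + 1 + 1) * (q + 1 + 1 + 1) = q * (q + 1) + 2 * (2 * q + 3) := by ring
    have e2 : (q + 1 + 1 - 1) * (q + 1 + 1 - 2) = q * (q + 1) := by
      simp [Nat.mul_comm]
    have e3 := Nat.even_mul_succ_self q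
    obtain ⟨t, ht⟩ := e3
    have e4 : (q + 1) * (q + 1) = q * (q + 1) + (q + 1) := by ring
    rw [e1, e2, e4, ht]
    omega
  rw [h4]
  simp only [Nat.add_sub_cancel]
  omega

section

variable {n : ℕ} {h : Fin n → Fin n}

theorem hessMat_sMat_inl [NeZero n] (a r : Fin n) (c : Fin ((a : ℕ) + 1)) :
    hessMat n (sMat n) h a r (Sum.inl c) =
      if r = 0 then X ((0 : Fin n), Fin.castLE a.isLt c) else 0 := by
  by_cases hr : r = 0 <;> simp [hessMat, sMat, Matrix.diagonal_apply, hr]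

theorem hessMat_inr (x : Matrix (Fin n) (Fin n) ℂ) (a r : Fin n) (c : Fin ((h a : ℕ) + 1)) :
    hessMat n x h a r (Sum.inr c) = X (r, Fin.castLE (h a).isLt c) := rfl

theorem det_submatrix_hessMat_mem (x : Matrix (Fin n) (Fin n) ℂ) (a : Fin n)
    (f : Fin ((h a : ℕ) + 2) → Fin n)
    (g : Fin ((h a : ℕ) + 2) → Fin ((a : ℕ) + 1) ⊕ Fin ((h a : ℕ) + 1)) :
    ((hessMat n x h a).submatrix f g).det ∈ hessIdeal n x h := by
  rw [hessIdeal, Ideal.sum_eq_sup]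
  exact Finset.le_sup (f := fun a ↦ hessIdealAt n x h a) (Finset.mem_univ a)
    (Ideal.subset_span ⟨f, g, rfl⟩)

theorem hessIdeal_le {x : Matrix (Fin n) (Fin n) ℂ} {J : Ideal (R n)}
    (hJ : ∀ (a : Fin n) (f : Fin ((h a : ℕ) + 2) → Fin n)
      (g : Fin ((h a : ℕ) + 2) → Fin ((a : ℕ) + 1) ⊕ Fin ((h a : ℕ) + 1)),
      ((hessMat n x h a).submatrix f g).det ∈ J) : hessIdeal n x h ≤ J := by
  rw [hessIdeal, Ideal.sum_eq_sup]
  refine Finset.sup_le fun a _ ↦ Ideal.span_le.mpr ?_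
  rintro _ ⟨f, g, rfl⟩
  exact hJ a f g

/-- The minors of `hessMat` vanish at a matrix whose first row vanishes left of column `k` and
whose column `h k` is, below the first row, a combination of the columns left of it. -/
theorem hessIdeal_le_ker [NeZero n] {K : Type*} [Field K] [Algebra ℂ K] (hh : IsHessenberg n h)
    (k : Fin n) (W : Fin n → Fin n → K) (hW : ∀ m < k, W 0 m = 0) (c : Fin n → K)
    (hc : ∀ r, r ≠ 0 → W r (h k) = ∑ m ∈ Finset.Iio (h k), c m * W r m) :
    hessIdeal n (sMat n) h ≤ RingHom.ker (aeval (R := ℂ) fun p : Fin n × Fin n ↦ W p.1 p.2) := by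
  set ψ := aeval (R := ℂ) fun p : Fin n × Fin n ↦ W p.1 p.2 with hψ
  refine hessIdeal_le fun a f g ↦ ?_
  rw [RingHom.mem_ker, AlgHom.map_det, AlgHom.mapMatrix_apply, ← Matrix.submatrix_map]
  let w : Fin ((h a : ℕ) + 1) → Fin n → K := fun m ↦
    if k ≤ a ∧ Fin.castLE (h a).isLt m = h k then Pi.single 0 1
    else fun r ↦ W r (Fin.castLE (h a).isLt m)
  have hv (m : Fin n) (hm : m ≤ h a) (hm' : ¬ (k ≤ a ∧ m = h k)) :
      (fun r ↦ W r m) ∈ Submodule.span K (Set.range w) := by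
    refine Submodule.subset_span ⟨⟨m, Nat.lt_succ_of_le hm⟩, ?_⟩
    exact if_neg hm'
  have he (hka : k ≤ a) : (Pi.single 0 1 : Fin n → K) ∈ Submodule.span K (Set.range w) :=
    Submodule.subset_span ⟨⟨h k, Nat.lt_succ_of_le (hh.1 hka)⟩, if_pos ⟨hka, rfl⟩⟩
  have hvj (hka : k ≤ a) : (fun r ↦ W r (h k)) ∈ Submodule.span K (Set.range w) := by
    have : (fun r ↦ W r (h k)) = ∑ m ∈ Finset.Iio (h k), c m • (fun r ↦ W r m) +
        (W 0 (h k) - ∑ m ∈ Finset.Iio (h k), c m * W 0 m) • (Pi.single 0 1 : Fin n → K) := by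
      ext r
      by_cases hr : r = 0
      · subst hr; simp [Finset.sum_apply]
      · simp [Finset.sum_apply, hc r hr, hr]
    rw [this]
    refine add_mem (sum_mem fun m hm ↦ Submodule.smul_mem _ _ ?_) (Submodule.smul_mem _ _ (he hka))
    rw [Finset.mem_Iio] at hm
    exact hv m (hm.le.trans (hh.1 hka)) fun hm' ↦ hm.ne hm'.2
  refine det_submatrix_eq_zero_of_forall_mem_span _ w (by simp) (fun j ↦ ?_) f g
  rcases j with m | m
  · have hcol : (fun r ↦ ((hessMat n (sMat n) h a).map ψ) r (Sum.inl m)) =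
        W 0 (Fin.castLE a.isLt m) • (Pi.single 0 1 : Fin n → K) := by
      ext r
      by_cases hr : r = 0 <;> simp [hessMat_sMat_inl, hr, hψ]
    rw [hcol]
    by_cases hka : k ≤ a
    · exact Submodule.smul_mem _ _ (he hka)
    · rw [hW _ (lt_of_le_of_lt (Nat.le_of_lt_succ m.isLt : Fin.castLE a.isLt m ≤ a)
        (not_le.mp hka)), zero_smul]
      exact zero_mem _
  · have hcol : (fun r ↦ ((hessMat n (sMat n) h a).map ψ) r (Sum.inr m)) =
        fun r ↦ W r (Fin.castLE (h a).isLt m) := by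
      ext r
      simp [hessMat_inr, hψ]
    rw [hcol]
    by_cases hm : k ≤ a ∧ Fin.castLE (h a).isLt m = h k
    · rw [hm.2]
      exact hvj hm.1
    · exact hv _ (Nat.le_of_lt_succ m.isLt) hm

theorem exists_sum_mul_X_eq (j : Fin n) : ∃ c : Fin n → FractionRing (R n),
    ∀ t : Fin j, ∑ m ∈ Finset.Iio j, c m *
      algebraMap (R n) (FractionRing (R n)) (X (⟨t + 1, by omega⟩, m)) =
      algebraMap (R n) (FractionRing (R n)) (X (⟨t + 1, by omega⟩, j)) := by
  let A : Matrix (Fin j) (Fin j) (R n) :=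
    Matrix.of fun t s ↦ X (⟨t + 1, by omega⟩, Fin.castLE j.isLt.le s)
  have hA : A.det ≠ 0 := by
    intro hA
    have := congrArg (eval fun p : Fin n × Fin n ↦ if (p.1 : ℕ) = p.2 + 1 then (1 : ℂ) else 0) hA
    rw [RingHom.map_det, map_zero] at this
    have h1 : (eval fun p : Fin n × Fin n ↦
        if (p.1 : ℕ) = p.2 + 1 then (1 : ℂ) else 0).mapMatrix A = 1 := by
      ext t s
      simp [A, Matrix.one_apply, Fin.ext_iff]
    rw [h1, Matrix.det_one] at this
    exact one_ne_zero this
  let A' := (algebraMap (R n) (FractionRing (R n))).mapMatrix A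
  have hA' : IsUnit A'.det := by
    rw [isUnit_iff_ne_zero, ← RingHom.map_det]
    simpa using hA
  let y : Fin j → FractionRing (R n) := fun t ↦
    algebraMap (R n) (FractionRing (R n)) (X (⟨t + 1, by omega⟩, j))
  let b := A'⁻¹.mulVec y
  have hb : A'.mulVec b = y := by
    rw [Matrix.mulVec_mulVec, Matrix.mul_nonsing_inv _ hA', Matrix.one_mulVec]
  refine ⟨fun m ↦ if hm : m < j then b ⟨m, hm⟩ else 0, fun t ↦ ?_⟩
  refine Eq.trans ?_ (congrFun hb t)
  rw [Matrix.mulVec, dotProduct]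
  refine (Finset.sum_bij (fun s _ ↦ Fin.castLE j.isLt.le s) ?_ ?_ ?_ ?_).symm
  · intro s _
    rw [Finset.mem_Iio]
    exact s.isLt
  · intro s _ s' _ hs
    exact Fin.castLE_injective _ hs
  · intro m hm
    rw [Finset.mem_Iio] at hm
    exact ⟨⟨m, hm⟩, Finset.mem_univ _, rfl⟩
  · intro s _
    have : Fin.castLE j.isLt.le s < j := s.isLt
    simp [this, A', A, mul_comm]

/-- The entry of the generic matrix attached to an element of `HessIndex n k j j`. -/
def hessEntry [NeZero n] (k j : Fin n) : HessIndex n k j j → Fin n × Fin n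
  | .inl m => (0, m)
  | .inr (.inl p) => (p.1, p.2)
  | .inr (.inr m) => (⟨m.1 + 1, lt_of_le_of_lt
      (Nat.succ_le_of_lt (lt_of_le_of_ne m.2.1 m.2.2 : m.1 < j)) j.isLt⟩, j)

theorem hessEntry_injective [NeZero n] (k j : Fin n) : Function.Injective (hessEntry k j) := by
  rintro (⟨a, ha⟩ | ⟨⟨a, ha⟩, ⟨a', ha'⟩⟩ | ⟨a, ha, ha'⟩)
    (⟨b, hb⟩ | ⟨⟨b, hb⟩, ⟨b', hb'⟩⟩ | ⟨b, hb, hb'⟩) hab <;>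
  simp only [hessEntry, Prod.mk.injEq, Fin.ext_iff] at hab <;> grind

theorem card_hessIndex_le_ringKrullDim [NeZero n] (hh : IsHessenberg n h) (k : Fin n) :
    Fintype.card (HessIndex n k (h k) (h k)) ≤ ringKrullDim (R n ⧸ hessIdeal n (sMat n) h) := by
  obtain ⟨c, hc⟩ := exists_sum_mul_X_eq (h k)
  let x : Fin n → Fin n → FractionRing (R n) := fun r m ↦
    algebraMap (R n) (FractionRing (R n)) (X (r, m))
  let W : Fin n → Fin n → FractionRing (R n) := fun r m ↦
    if r = 0 then (if m < k then 0 else x r m)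
    else if m = h k then ∑ m ∈ Finset.Iio (h k), c m * x r m else x r m
  let ψ := aeval (R := ℂ) fun p : Fin n × Fin n ↦ W p.1 p.2
  have hle : hessIdeal n (sMat n) h ≤ RingHom.ker ψ := by
    refine hessIdeal_le_ker hh k W (fun m hm ↦ by simp [W, hm]) c fun r hr ↦ ?_
    simp only [W, if_neg hr, if_true]
    refine Finset.sum_congr rfl fun m hm ↦ ?_
    rw [if_neg (Finset.mem_Iio.mp hm).ne]
  have hψ (i) : ψ (X (hessEntry k (h k) i)) =
      algebraMap (R n) (FractionRing (R n)) (X (hessEntry k (h k) i)) := by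
    simp only [ψ, aeval_X]
    rcases i with m | p | m
    · simp [hessEntry, W, x, m.2]
    · simp [hessEntry, W, x, p.1.2, p.2.2]
    · have hm : m.1 < h k := lt_of_le_of_ne m.2.1 m.2.2
      have := hc ⟨m.1, hm⟩
      have h0 : (hessEntry k (h k) (Sum.inr (Sum.inr m))).1 ≠ 0 := fun h0 ↦
        Nat.succ_ne_zero m.1.1 (congrArg Fin.val h0)
      have h1 : (hessEntry k (h k) (Sum.inr (Sum.inr m))).2 = h k := rfl
      change (if _ then _ else if _ then _ else _) = _
      rw [if_neg h0, if_pos h1]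
      exact this
  have : (RingHom.ker ψ).IsPrime := RingHom.ker_isPrime ψ
  refine le_trans ?_ (ringKrullDim_le_of_surjective (Ideal.Quotient.factor hle)
    (Ideal.Quotient.factor_surjective hle))
  refine card_le_ringKrullDim_of_algebraicIndependent (k := ℂ)
    (fun i ↦ Ideal.Quotient.mk (RingHom.ker ψ) (X (hessEntry k (h k) i))) ?_
  refine AlgebraicIndependent.of_comp (Ideal.kerLiftAlg ψ) ?_
  have hX := ((algebraicIndependent_X (Fin n × Fin n) ℂ).map'
    (f := IsScalarTower.toAlgHom ℂ (R n) (FractionRing (R n)))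
    (IsFractionRing.injective (R n) (FractionRing (R n)))).comp _ (hessEntry_injective k (h k))
  have hcomp : Ideal.kerLiftAlg ψ ∘ (fun i ↦ Ideal.Quotient.mk (RingHom.ker ψ)
      (X (hessEntry k (h k) i))) = (IsScalarTower.toAlgHom ℂ (R n) (FractionRing (R n)) ∘ X) ∘
        hessEntry k (h k) := funext hψ
  rw [hcomp]
  exact hX

/-- The columns `0, …, h k` of a zero of `hessIdeal n (sMat n) h` are linearly dependent below the
first row as soon as the entry `(0, k)` does not vanish. -/
theorem exists_sum_mul_eq_zero [NeZero n] {F : Type*} [Field F] [Algebra ℂ F] (ψ : R n →ₐ[ℂ] F)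
    (hψ : hessIdeal n (sMat n) h ≤ RingHom.ker ψ) (k : Fin n)
    (hk : ψ (X (0, k)) ≠ 0 ∨ (h k : ℕ) + 1 = n) :
    ∃ c : Fin n → F, (∀ r, r ≠ 0 → ∑ m ∈ Finset.Iic (h k), c m * ψ (X (r, m)) = 0) ∧
      ∃ l ≤ h k, c l ≠ 0 := by
  let u : Fin ((h k : ℕ) + 1) → {r : Fin n // r ≠ 0} → F :=
    fun m r ↦ ψ (X (r.1, Fin.castLE (h k).isLt m))
  have hu : ¬ LinearIndependent F u := by
    intro hu
    have hcard := hu.fintype_card_le_finrank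
    rcases hk with hk | hk
    swap
    · have := NeZero.pos n
      simp [Fintype.card_subtype_compl] at hcard
      omega
    let g : Fin ((h k : ℕ) + 2) → Fin ((k : ℕ) + 1) ⊕ Fin ((h k : ℕ) + 1) :=
      Fin.cons (Sum.inl (Fin.last k)) Sum.inr
    let M : Matrix (Fin n) (Fin ((h k : ℕ) + 2)) F :=
      ((hessMat n (sMat n) h k).map ψ).submatrix id g
    have hM : LinearIndependent F M.col := by
      rw [Fintype.linearIndependent_iff]
      intro b hb
      have hb' (r : Fin n) : b 0 * M r 0 + ∑ m, b (Fin.succ m) * M r (Fin.succ m) = 0 := by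
        have := congrFun hb r
        simpa [Fin.sum_univ_succ, Finset.sum_apply] using this
      have hM0 (r : Fin n) : M r 0 = if r = 0 then ψ (X (0, k)) else 0 := by
        by_cases hr : r = 0
        · simp [M, g, hessMat_sMat_inl, hr]
          rfl
        · simp [M, g, hessMat_sMat_inl, hr]
      have hMs (r : Fin n) (m) : M r (Fin.succ m) = ψ (X (r, Fin.castLE (h k).isLt m)) := by
        simp [M, g, hessMat_inr]
      have hbs : ∀ m, b (Fin.succ m) = 0 := by
        refine Fintype.linearIndependent_iff.mp hu _ ?_
        ext r
        have := hb' r.1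
        simpa [hM0, hMs, r.2, u, Finset.sum_apply] using this
      have hb0 : b 0 = 0 := by
        have := hb' 0
        simpa [hM0, hbs, hk] using this
      exact Fin.cases hb0 hbs
    obtain ⟨f, hf⟩ := exists_det_submatrix_ne_zero M hM
    apply hf
    have := hψ (det_submatrix_hessMat_mem (sMat n) k f g)
    rwa [RingHom.mem_ker, AlgHom.map_det, AlgHom.mapMatrix_apply, ← Matrix.submatrix_map] at this
  rw [Fintype.not_linearIndependent_iff] at hu
  obtain ⟨b, hb, l, hl⟩ := hu
  refine ⟨fun m ↦ if hm : m ≤ h k then b ⟨m, Nat.lt_succ_of_le hm⟩ else 0, fun r hr ↦ ?_,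
    Fin.castLE (h k).isLt l, Nat.le_of_lt_succ l.isLt, ?_⟩
  · have := congrFun hb ⟨r, hr⟩
    simp only [Finset.sum_apply, Pi.smul_apply, smul_eq_mul, Pi.zero_apply, u] at this
    refine Eq.trans ?_ this
    refine (Finset.sum_bij (fun s _ ↦ Fin.castLE (h k).isLt s) ?_ ?_ ?_ ?_).symm
    · intro s _
      rw [Finset.mem_Iic]
      exact Nat.le_of_lt_succ s.isLt
    · intro s _ s' _ hs
      exact Fin.castLE_injective _ hs
    · intro m hm
      rw [Finset.mem_Iic] at hm
      exact ⟨⟨m, Nat.lt_succ_of_le hm⟩, Finset.mem_univ _, rfl⟩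
    · intro s _
      have hs : Fin.castLE (h k).isLt s ≤ h k := Nat.le_of_lt_succ s.isLt
      simp [hs]
  · have hl' : Fin.castLE (h k).isLt l ≤ h k := Nat.le_of_lt_succ l.isLt
    simpa [hl'] using hl

theorem exists_ringKrullDim_quotient_le [NeZero n] {P : Ideal (R n)} (hP : P.IsPrime)
    (hIP : hessIdeal n (sMat n) h ≤ P) (hh : IsHessenberg n h) :
    ∃ k l : Fin n, l ≤ h k ∧
      ringKrullDim (R n ⧸ P) ≤ Fintype.card (HessIndex n k (h k) l) := by
  obtain ⟨k, hk0, hk⟩ : ∃ k : Fin n, (∀ m < k, (X (0, m) : R n) ∈ P) ∧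
      ((X (0, k) : R n) ∉ P ∨ (h k : ℕ) + 1 = n) := by
    by_cases hex : ∃ k : Fin n, (X (0, k) : R n) ∉ P
    · obtain ⟨k, hk, hmin⟩ := wellFounded_lt.has_min {k : Fin n | (X (0, k) : R n) ∉ P} hex
      exact ⟨k, fun m hm ↦ not_not.mp fun hm' ↦ hmin m hm' hm, .inl hk⟩
    · push Not at hex
      have hn := NeZero.pos n
      refine ⟨⟨n - 1, by omega⟩, fun m _ ↦ hex m, .inr ?_⟩
      have := Fin.le_def.mp (hh.2 ⟨n - 1, by omega⟩)
      have := (h ⟨n - 1, by omega⟩).isLt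
      simp only at *
      omega
  let F := FractionRing (R n ⧸ P)
  let ι : (R n ⧸ P) →ₐ[ℂ] F := IsScalarTower.toAlgHom ℂ (R n ⧸ P) F
  have hι : Function.Injective ι := IsFractionRing.injective (R n ⧸ P) F
  let ψ : R n →ₐ[ℂ] F := ι.comp (Ideal.Quotient.mkₐ ℂ P)
  have hψ (p : R n) : ψ p = 0 ↔ p ∈ P := by
    rw [← Ideal.Quotient.eq_zero_iff_mem]
    exact map_eq_zero_iff ι hι
  obtain ⟨c, hc, l, hl, hcl⟩ := exists_sum_mul_eq_zero ψ
    (fun p hp ↦ RingHom.mem_ker.mpr ((hψ p).mpr (hIP hp))) k (by rwa [Ne, hψ])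
  refine ⟨k, l, hl, ?_⟩
  let x : HessIndex n k (h k) l → F := Sum.elim (fun m ↦ ψ (X (0, m.1)))
    (Sum.elim (fun p ↦ ψ (X (p.1.1, p.2.1))) fun m ↦ -(c m.1 / c l))
  have hx (i) : x i ∈ (aeval (R := ℂ) x).range := ⟨X i, by simp⟩
  have hother (r m : Fin n) (hr : r ≠ 0) (hm : m ≠ l) :
      ψ (X (r, m)) ∈ (aeval (R := ℂ) x).range := hx (.inr (.inl (⟨r, hr⟩, ⟨m, hm⟩)))
  refine ringKrullDim_le_card_of_mem_range (k := ℂ) ι hι x ?_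
  have hle : ψ.range ≤ (aeval (R := ℂ) x).range := by
    rw [← Algebra.map_top, ← MvPolynomial.adjoin_range_X, AlgHom.map_adjoin, Algebra.adjoin_le_iff]
    rintro _ ⟨_, ⟨⟨r, m⟩, rfl⟩, rfl⟩
    change ψ (X (r, m)) ∈ (aeval (R := ℂ) x).range
    by_cases hr : r = 0
    · subst hr
      by_cases hm : m < k
      · rw [(hψ _).mpr (hk0 m hm)]
        exact zero_mem _
      · exact hx (.inl ⟨m, not_lt.mp hm⟩)
    · by_cases hm : m = l
      · subst hm
        have hsum : ψ (X (r, m)) =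
            ∑ t ∈ (Finset.Iic (h k)).erase m, -(c t / c m) * ψ (X (r, t)) := by
          have := hc r hr
          rw [← Finset.add_sum_erase _ _ (Finset.mem_Iic.mpr hl)] at this
          apply mul_left_cancel₀ hcl
          rw [eq_neg_of_add_eq_zero_left this, Finset.mul_sum, ← Finset.sum_neg_distrib]
          refine Finset.sum_congr rfl fun t _ ↦ ?_
          rw [neg_mul, mul_neg, ← mul_assoc, mul_div_cancel₀ _ hcl]
        rw [hsum]
        refine sum_mem fun t ht ↦ ?_
        rw [Finset.mem_erase, Finset.mem_Iic] at ht
        exact mul_mem (hx (.inr (.inr ⟨t, ht.2, ht.1⟩))) (hother r t hr ht.1)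
      · exact hother r m hr hm
  rintro _ ⟨y, rfl⟩
  obtain ⟨p, rfl⟩ := Ideal.Quotient.mk_surjective y
  exact hle ⟨p, rfl⟩

theorem sub_le_of_forall_hessCorner {d : ℕ}
    (hd : ∀ i : Fin n, HessCorner n h i → (h i : ℕ) - i ≤ d) (k : Fin n) :
    (h k : ℕ) - k ≤ d := by
  obtain ⟨k, hk⟩ := k
  induction k with
  | zero => exact hd _ (.inl rfl)
  | succ k ih =>
    by_cases hc : HessCorner n h ⟨k + 1, hk⟩
    · exact hd _ hc
    · have hle : h ⟨k + 1, hk⟩ ≤ h ⟨k, by omega⟩ := not_lt.mp fun hlt ↦ hc (.inr hlt)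
      have := ih (by omega)
      have := Fin.le_def.mp hle
      simp only at *
      omega

end

/-- Corollary 4.4: the Krull dimension of `R / I_{s,h}` equals
`n(n+1)/2 + (n-1)(n-2)/2 + max_{i ∈ C(h)} (h(i) - i)` (the difference `h(i) - i` is the
same 0-based or 1-based; `d` is characterized as the maximum over the corner set). -/
theorem stmt11 (n : ℕ) [NeZero n] (h : Fin n → Fin n) (hh : IsHessenberg n h)
    (d : ℕ) (hd1 : ∃ i : Fin n, HessCorner n h i ∧ d = ((h i) : ℕ) - (i : ℕ))
    (hd2 : ∀ i : Fin n, HessCorner n h i → ((h i) : ℕ) - (i : ℕ) ≤ d) :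
    ringKrullDim (R n ⧸ hessIdeal n (sMat n) h) =
      ((n * (n + 1) / 2 + (n - 1) * (n - 2) / 2 + d : ℕ) : WithBot ℕ∞) := by
  refine le_antisymm (ringKrullDim_quotient_le_of_forall_isPrime _ _ fun P hP hIP ↦ ?_) ?_
  · obtain ⟨k, l, hl, hle⟩ := exists_ringKrullDim_quotient_le hP hIP hh
    refine hle.trans ?_
    rw [card_hessIndex n k (h k) l (hh.2 k) hl]
    exact_mod_cast Nat.add_le_add_left (sub_le_of_forall_hessCorner hd2 k) _
  · obtain ⟨i, -, rfl⟩ := hd1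
    rw [← card_hessIndex n i (h i) (h i) (hh.2 i) le_rfl]
    exact card_hessIndex_le_ringKrullDim hh i
end
end

section
/- For every i ∈ {1, …, n−1}, the image of the ideal K_i under the ℂ-algebra automorphism of R determined by z_{kj} ↦ z_{n+1−k, j} equals the Schubert determinantal ideal I_{v[i]} of the permutation v[i]. -/
open MvPolynomial

noncomputable section

/-- A minor of the generic matrix, with rows listed by `f` and columns by `g`. -/
def genMinor {n k : ℕ} (f g : Fin k → Fin n) : R n :=
  (Matrix.of fun a b => (X (f a, g b) : R n)).det

lemma genMinor_eq_zero_of_not_injective_left {n k : ℕ} {f g : Fin k → Fin n}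
    (hf : ¬ Function.Injective f) : genMinor f g = 0 := by
  simp only [Function.Injective, not_forall] at hf
  obtain ⟨a, b, hab, hne⟩ := hf
  exact Matrix.det_zero_of_row_eq hne (by ext c; simp [hab])

lemma genMinor_eq_zero_of_not_injective_right {n k : ℕ} {f g : Fin k → Fin n}
    (hg : ¬ Function.Injective g) : genMinor f g = 0 := by
  simp only [Function.Injective, not_forall] at hg
  obtain ⟨a, b, hab, hne⟩ := hg
  exact Matrix.det_zero_of_column_eq hne (by intro c; simp [hab])

lemma genMinor_comp_perm_left_mem {n k : ℕ} {f g : Fin k → Fin n} {I : Ideal (R n)}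
    (σ : Equiv.Perm (Fin k)) (h : genMinor (f ∘ σ) g ∈ I) : genMinor f g ∈ I := by
  have key : genMinor (f ∘ σ) g = (Equiv.Perm.sign σ : ℤ) * genMinor f g := by
    exact Matrix.det_permute σ (Matrix.of fun a b => (X (f a, g b) : R n))
  rw [key] at h
  rcases Int.units_eq_one_or (Equiv.Perm.sign σ) with hs | hs <;> simpa [hs] using h

lemma genMinor_comp_perm_right_mem {n k : ℕ} {f g : Fin k → Fin n} {I : Ideal (R n)}
    (σ : Equiv.Perm (Fin k)) (h : genMinor f g ∈ I) : genMinor f (g ∘ σ) ∈ I := by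
  have key : genMinor f (g ∘ σ) = (Equiv.Perm.sign σ : ℤ) * genMinor f g := by
    exact Matrix.det_permute' σ (Matrix.of fun a b => (X (f a, g b) : R n))
  rw [key]
  exact Ideal.mul_mem_left _ _ h

/-- Reversal of the rows of the generic matrix, as an algebra endomorphism. -/
abbrev revRows (n : ℕ) : R n →ₐ[ℂ] R n :=
  MvPolynomial.rename fun q : Fin n × Fin n => (q.1.rev, q.2)

lemma revRows_genMinor {n k : ℕ} (f g : Fin k → Fin n) :
    revRows n (genMinor f g) = genMinor (Fin.rev ∘ f) g := by
  rw [genMinor, AlgHom.map_det]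
  congr 1
  ext1 a b
  simp

/-- The row-reversed ideal contains every minor on the leading `i` columns that avoids the
last row. -/
lemma genMinor_leading_mem_map_Kideal {n i : ℕ} {f g : Fin i → Fin n}
    (hf : ∀ a, (f a : ℕ) < n - 1) (hg : ∀ b, (g b : ℕ) = b) :
    genMinor f g ∈ Ideal.map (revRows n) (Kideal n i) := by
  by_cases hinj : Function.Injective f
  swap
  · simp [genMinor_eq_zero_of_not_injective_left hinj]
  have hin : i ≤ n := by simpa using Fintype.card_le_of_injective f hinj
  set B : Fin i → Fin n := Fin.rev ∘ f
  set σ := Tuple.sort B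
  have hB : StrictMono (B ∘ σ) := (Tuple.monotone_sort B).strictMono_of_injective
    ((Fin.rev_injective.comp hinj).comp σ.injective)
  have hgen : genMinor (B ∘ σ) g ∈ Kideal n i := by
    refine Ideal.subset_span ⟨hin, B ∘ σ, hB, fun k => ?_, ?_⟩
    · have := hf (σ k)
      simp only [B, Function.comp_apply, Fin.val_rev]
      omega
    · rw [show g = Fin.castLE hin from funext fun b => Fin.ext (hg b)]
      rfl
  refine genMinor_comp_perm_left_mem σ ?_
  have himage := Ideal.mem_map_of_mem (revRows n) hgen
  rw [revRows_genMinor] at himage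
  convert himage using 2
  ext a
  simp [B]

/-- Laplace expansion along the last column extends this to larger leading minors. -/
lemma genMinor_mem_map_Kideal {n i k : ℕ} (hik : i ≤ k) {f g : Fin k → Fin n}
    (hf : ∀ a, (f a : ℕ) < n - 1) (hg : ∀ b, (g b : ℕ) = b) :
    genMinor f g ∈ Ideal.map (revRows n) (Kideal n i) := by
  induction k, hik using Nat.le_induction with
  | base => exact genMinor_leading_mem_map_Kideal hf hg
  | succ k hik ih =>
    rw [genMinor, Matrix.det_succ_column _ (Fin.last k)]
    refine Ideal.sum_mem _ fun a _ => Ideal.mul_mem_left _ _ ?_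
    exact ih (f := f ∘ a.succAbove) (g := g ∘ (Fin.last k).succAbove)
      (fun _ => hf _) (fun b => by simp [hg])

lemma genMinor_mem_schubertIdeal {n k : ℕ} {w : Equiv.Perm (Fin n)} {p q : Fin n}
    (hk : k = rankpq n w p q + 1) {f g : Fin k → Fin n}
    (hf : ∀ a, f a ≤ p) (hg : ∀ b, g b ≤ q) : genMinor f g ∈ schubertIdeal n w := by
  subst hk
  exact Ideal.subset_span ⟨p, q, f, g, hf, hg, rfl⟩

lemma le_of_injective_of_forall_le {n k : ℕ} {f : Fin k → Fin n} {p : Fin n}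
    (hinj : Function.Injective f) (hf : ∀ a, f a ≤ p) : k ≤ p + 1 := by
  have h := Finset.card_le_card_of_injOn (s := Finset.univ) (t := Finset.Iic p) f
    (by simpa [Set.MapsTo] using hf) hinj.injOn
  simpa using h

/-- `v` is the permutation with `v[k]` in 0-based form, `m = k - 1`: it sends position `m` to
the last value and is increasing elsewhere. -/
def IsShift (n m : ℕ) (v : Equiv.Perm (Fin n)) : Prop :=
  ∀ j : Fin n, ((j : ℕ) < m → v j = j) ∧
    ((j : ℕ) = m → ((v j) : ℕ) = n - 1) ∧ ((j : ℕ) > m → ((v j) : ℕ) = (j : ℕ) - 1)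

namespace IsShift

variable {n m : ℕ} {v : Equiv.Perm (Fin n)}

lemma apply_le (hv : IsShift n m v) {j : Fin n} (hj : (j : ℕ) ≠ m) : v j ≤ j := by
  rcases lt_or_gt_of_ne hj with h | h
  · exact ((hv j).1 h).le
  · have := (hv j).2.2 h
    rw [Fin.le_def]
    omega

lemma le_apply_add_one (hv : IsShift n m v) (j : Fin n) : (j : ℕ) ≤ v j + 1 := by
  rcases lt_trichotomy (j : ℕ) m with h | h | h
  · rw [(hv j).1 h]
    omega
  · have := (hv j).2.1 h
    omega
  · have := (hv j).2.2 h
    omega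

/-- The only rank conditions that are not vacuous, and the rank they impose. -/
lemma rankpq_eq (hv : IsShift n m v) {p q : Fin n}
    (hp : rankpq n v p q ≤ p) (hq : rankpq n v p q ≤ q) :
    m ≤ q ∧ (p : ℕ) < n - 1 ∧ rankpq n v p q = q := by
  have hpn : (p : ℕ) < n - 1 := by
    by_contra hcon
    have : Finset.Iic q ⊆ Finset.univ.filter fun j : Fin n => j ≤ q ∧ v j ≤ p := by
      intro j hj
      have := (v j).isLt
      simp only [Finset.mem_Iic] at hj
      simp only [Finset.mem_filter_univ, Fin.le_def]
      exact ⟨hj, by omega⟩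
    have := Finset.card_le_card this
    rw [Fin.card_Iic] at this
    unfold rankpq at hq
    omega
  have hqp : q ≤ p := by
    by_contra! hcon
    have : (Finset.Iic p).map v.symm.toEmbedding ⊆
        Finset.univ.filter fun j : Fin n => j ≤ q ∧ v j ≤ p := by
      intro j hj
      simp only [Finset.mem_map_equiv, Finset.mem_Iic, Equiv.symm_symm] at hj
      have := hv.le_apply_add_one j
      simp only [Finset.mem_filter_univ, Fin.le_def]
      rw [Fin.lt_def] at hcon
      rw [Fin.le_def] at hj
      omega
    have := Finset.card_le_card this
    rw [Finset.card_map, Fin.card_Iic] at this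
    unfold rankpq at hp
    omega
  have hmq : m ≤ q := by
    by_contra! hcon
    have : Finset.Iic q ⊆ Finset.univ.filter fun j : Fin n => j ≤ q ∧ v j ≤ p := by
      intro j hj
      simp only [Finset.mem_Iic] at hj
      have := hv.apply_le (j := j) (by rw [Fin.le_def] at hj; omega)
      simp only [Finset.mem_filter_univ]
      exact ⟨hj, this.trans (hj.trans hqp)⟩
    have := Finset.card_le_card this
    rw [Fin.card_Iic] at this
    unfold rankpq at hq
    omega
  refine ⟨hmq, hpn, hq.antisymm ?_⟩
  have : (Finset.Iic q).erase ⟨m, by omega⟩ ⊆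
      Finset.univ.filter fun j : Fin n => j ≤ q ∧ v j ≤ p := by
    intro j hj
    simp only [Finset.mem_erase, Finset.mem_Iic, ne_eq, Fin.ext_iff] at hj
    simp only [Finset.mem_filter_univ]
    exact ⟨hj.2, (hv.apply_le hj.1).trans (hj.2.trans hqp)⟩
  have := Finset.card_le_card this
  rwa [Finset.card_erase_of_mem (by simpa [Fin.le_def] using hmq), Fin.card_Iic] at this

lemma rankpq_essential (hv : IsShift n m v) {p q : Fin n} (hp : (p : ℕ) + 1 = n - 1)
    (hq : (q : ℕ) = m) : rankpq n v p q = m := by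
  have : (Finset.univ.filter fun j : Fin n => j ≤ q ∧ v j ≤ p) = Finset.Iio q := by
    ext j
    simp only [Finset.mem_filter_univ, Finset.mem_Iio, Fin.le_def, Fin.lt_def]
    refine ⟨fun ⟨h1, h2⟩ => ?_, fun h => ⟨h.le, ?_⟩⟩
    · by_contra hcon
      have := (hv j).2.1 (by omega)
      omega
    · rw [(hv j).1 (by omega)]
      omega
  rw [rankpq, this, Fin.card_Iio, hq]

lemma schubertIdeal_le (hv : IsShift n m v) :
    schubertIdeal n v ≤ Ideal.map (revRows n) (Kideal n (m + 1)) := by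
  refine Ideal.span_le.2 ?_
  rintro _ ⟨p, q, f, g, hf, hg, rfl⟩
  change genMinor f g ∈ _
  by_cases hfi : Function.Injective f
  swap
  · simp [genMinor_eq_zero_of_not_injective_left hfi]
  by_cases hgi : Function.Injective g
  swap
  · simp [genMinor_eq_zero_of_not_injective_right hgi]
  have hrp := le_of_injective_of_forall_le hfi hf
  have hrq := le_of_injective_of_forall_le hgi hg
  obtain ⟨hmq, hpn, hr⟩ := hv.rankpq_eq (p := p) (q := q) (by omega) (by omega)
  have hg' (b) : (g b : ℕ) < rankpq n v p q + 1 := by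
    have : (g b : ℕ) ≤ q := hg b
    omega
  let σ : Equiv.Perm (Fin (rankpq n v p q + 1)) :=
    Equiv.ofBijective (fun b => ⟨g b, hg' b⟩) <| Finite.injective_iff_bijective.1
      fun a b hab => hgi (Fin.ext (by simpa using hab))
  have hσ : g = Fin.castLE (by omega) ∘ σ := by
    ext b
    simp [σ]
  rw [hσ]
  refine genMinor_comp_perm_right_mem σ (genMinor_mem_map_Kideal (by omega) (fun a => ?_) ?_)
  · exact lt_of_le_of_lt (hf a) hpn
  · simp

lemma map_Kideal_le (hv : IsShift n m v) (hm : m + 1 ≤ n - 1) :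
    Ideal.map (revRows n) (Kideal n (m + 1)) ≤ schubertIdeal n v := by
  rw [Kideal, Ideal.map_span, Ideal.span_le]
  rintro _ ⟨_, ⟨hj, B, -, hB0, rfl⟩, rfl⟩
  change revRows n (genMinor B (Fin.castLE hj)) ∈ schubertIdeal n v
  rw [revRows_genMinor]
  refine genMinor_mem_schubertIdeal (p := ⟨n - 2, by omega⟩) (q := ⟨m, by omega⟩)
    (by rw [hv.rankpq_essential (by simp only; omega) rfl]) (fun a => ?_) (fun b => ?_)
  · have := hB0 a
    simp only [Function.comp_apply, Fin.le_def, Fin.val_rev]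
    omega
  · simp only [Fin.le_def, Fin.val_castLE]
    omega

end IsShift

/-- Lemma 2.2, second part: for `1 ≤ i ≤ n-1`, the image of `K_i` under the
automorphism `z_{kj} ↦ z_{n+1-k,j}` (0-based: `z_{kj} ↦ z_{rev k, j}`) is the Schubert
determinantal ideal of `v[i]`, the shortest permutation sending `i ↦ n` (0-based: `v` sends
position `i-1` to `n-1`, fixes positions `j < i-1`, and sends positions `j > i-1` to `j-1`). -/
theorem stmt15 (n : ℕ) [NeZero n] (i : ℕ) (hi1 : 1 ≤ i) (hi2 : i ≤ n - 1)
    (v : Equiv.Perm (Fin n))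
    (hv : ∀ j : Fin n, ((j : ℕ) < i - 1 → v j = j) ∧
      ((j : ℕ) = i - 1 → ((v j) : ℕ) = n - 1) ∧ ((j : ℕ) > i - 1 → ((v j) : ℕ) = (j : ℕ) - 1)) :
    Ideal.map (MvPolynomial.rename (fun q : Fin n × Fin n => (q.1.rev, q.2)) : R n →ₐ[ℂ] R n)
        (Kideal n i) =
      schubertIdeal n v := by
  obtain ⟨m, rfl⟩ := Nat.exists_eq_add_of_le' hi1
  have hv' : IsShift n m v := hv
  exact le_antisymm (hv'.map_Kideal_le hi2) hv'.schubertIdeal_le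
end
end
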